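/- arXiv:1406.1208 — 3 statements merged into one kernel-verified Lean document; each statement's English description precedes it below -/
import Mathlib

section
/- Let A be a unital C*-algebra, let α be a continuous action of the circle group 𝕋 on A, let μ be the Haar probability measure on 𝕋, and let v ∈ A be a unitary satisfying sup_{ζ∈𝕋} ‖α_ζ(v) − ζ·v‖ < 1/3. Set x = ∫_𝕋 ζ̄·α_ζ(v) dμ(ζ). Then ‖x⋆x − 1‖ < 1, so x⋆x is invertible, and the element u = x·(x⋆x)^{−1/2} (where (x⋆x)^{−1/2} is the inverse square root of the positive invertible element x⋆x, given by continuous functional calculus) is a unitary in A satisfying α_ζ(u) = ζ·u for every ζ ∈ 𝕋. -/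
open MeasureTheory

noncomputable instance : MeasurableSpace Circle := borel Circle
instance : BorelSpace Circle := ⟨rfl⟩

/-- A continuous action of the circle group `Circle` on a unital C*-algebra `A`:
a family of ⋆-automorphisms, multiplicative in the group variable, and point-norm continuous. -/
def IsCircleAction {A : Type*} [CStarAlgebra A] (α : Circle → A ≃⋆ₐ[ℂ] A) : Prop :=
  (∀ ζ₁ ζ₂ : Circle, ∀ a : A, α (ζ₁ * ζ₂) a = α ζ₁ (α ζ₂ a)) ∧
    ∀ a : A, Continuous fun ζ : Circle => α ζ a

theorem averaged_unitary_is_unitary {A : Type*} [CStarAlgebra A] [Nontrivial A]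
    (α : Circle → A ≃⋆ₐ[ℂ] A) (hα : IsCircleAction α)
    (μ : Measure Circle) [μ.IsHaarMeasure] [IsProbabilityMeasure μ]
    (v : A) (hv : v ∈ unitary A)
    (hsmall : (⨆ ζ : Circle, ‖α ζ v - (ζ : ℂ) • v‖) < 1 / 3)
    (x : A) (hx : x = ∫ ζ : Circle, (star (ζ : ℂ)) • (α ζ v) ∂μ) :
    ‖star x * x - 1‖ < 1 ∧ IsUnit (star x * x) ∧
      x * cfc (fun r : ℝ => r ^ (-(1 / 2 : ℝ))) (star x * x) ∈ unitary A ∧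
      ∀ ζ : Circle,
        α ζ (x * cfc (fun r : ℝ => r ^ (-(1 / 2 : ℝ))) (star x * x)) =
          (ζ : ℂ) • (x * cfc (fun r : ℝ => r ^ (-(1 / 2 : ℝ))) (star x * x)) := by
  obtain ⟨hmul, hcont⟩ := hα
  set s : ℝ := ⨆ ζ : Circle, ‖α ζ v - (ζ : ℂ) • v‖ with hs
  have hvn : ‖v‖ = 1 := CStarRing.norm_of_mem_unitary hv
  have hζs : ∀ ζ : Circle, (star (ζ : ℂ)) * (ζ : ℂ) = 1 := fun ζ => by
    have := Complex.conj_mul' (ζ : ℂ)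
    rw [Circle.norm_coe] at this
    simpa using this
  have hζn : ∀ ζ : Circle, ‖star (ζ : ℂ)‖ = 1 := fun ζ => by rw [norm_star, Circle.norm_coe]
  have hcc : Continuous fun ζ : Circle => (ζ : ℂ) := continuous_subtype_val
  have hbdd : BddAbove (Set.range fun ζ : Circle => ‖α ζ v - (ζ : ℂ) • v‖) := by
    have : Continuous fun ζ : Circle => ‖α ζ v - (ζ : ℂ) • v‖ :=
      ((hcont v).sub (hcc.smul continuous_const)).norm
    exact (isCompact_range this).bddAbove
  have hle : ∀ ζ : Circle, ‖α ζ v - (ζ : ℂ) • v‖ ≤ s := fun ζ => le_ciSup hbdd ζ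
  have hfc : Continuous fun ζ : Circle => (star (ζ : ℂ)) • (α ζ v) :=
    (hcc.star).smul (hcont v)
  have hfi : Integrable (fun ζ : Circle => (star (ζ : ℂ)) • (α ζ v)) μ := by
    rw [← integrableOn_univ]
    exact hfc.continuousOn.integrableOn_compact isCompact_univ
  have hαn : ∀ ζ a, ‖α ζ a‖ = ‖a‖ := fun ζ a => NonUnitalStarAlgHom.norm_map (α ζ) (α ζ).injective a
  have hxn : ‖x‖ ≤ 1 := by
    rw [hx]
    refine (norm_integral_le_of_norm_le_const (C := 1) (Filter.Eventually.of_forall fun ζ => ?_)).trans ?_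
    · rw [norm_smul, hζn, hαn, hvn, one_mul]
    · simp
  have hxv : ‖x - v‖ ≤ s := by
    have : x - v = ∫ ζ : Circle, ((star (ζ : ℂ)) • (α ζ v) - v) ∂μ := by
      rw [integral_sub hfi (integrable_const v), ← hx]; simp
    rw [this]
    refine (norm_integral_le_of_norm_le_const (C := s) (Filter.Eventually.of_forall fun ζ => ?_)).trans ?_
    · have h1 : (star (ζ : ℂ)) • (α ζ v) - v = (star (ζ : ℂ)) • (α ζ v - (ζ : ℂ) • v) := by
        rw [smul_sub, smul_smul, hζs, one_smul]
      rw [h1, norm_smul, hζn, one_mul]; exact hle ζ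
    · simp
  have hvv : star v * v = 1 := (Unitary.mem_iff.1 hv).1
  have hvv' : v * star v = 1 := (Unitary.mem_iff.1 hv).2
  have h1 : ‖star x * x - 1‖ < 1 := by
    have e : star x * x - 1 = star x * (x - v) + star (x - v) * v := by
      rw [star_sub, mul_sub, sub_mul, hvv]; abel
    rw [e]
    have a1 := norm_add_le (star x * (x - v)) (star (x - v) * v)
    have a2 := norm_mul_le (star x) (x - v)
    have a3 := norm_mul_le (star (x - v)) v
    rw [norm_star] at a2 a3
    rw [hvn] at a3
    have a4 : ‖x‖ * ‖x - v‖ ≤ 1 * ‖x - v‖ := mul_le_mul_of_nonneg_right hxn (norm_nonneg _)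
    linarith
  have hunit : ∀ y : A, ‖y - 1‖ < 1 → IsUnit y := fun y hy => by
    have := isUnit_one_sub_of_norm_lt_one (x := 1 - y) (by rwa [norm_sub_rev])
    simpa using this
  have h2 := hunit _ h1
  have hxu : IsUnit x := by
    have h3 : IsUnit (star v * x) := by
      apply hunit
      have : star v * x - 1 = star v * (x - v) := by rw [mul_sub, hvv]
      rw [this]
      have a2 := norm_mul_le (star v) (x - v)
      rw [norm_star, hvn] at a2
      linarith
    have h4 : IsUnit v := ⟨⟨v, star v, hvv', hvv⟩, rfl⟩
    have := h4.mul h3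
    rwa [← mul_assoc, hvv', one_mul] at this
  have hsa : IsSelfAdjoint (star x * x) := IsSelfAdjoint.star_mul_self x
  have hpos : ∀ r ∈ spectrum ℝ (star x * x), 0 < r := fun r hr => by
    refine lt_of_le_of_ne (spectrum_star_mul_self_nonneg r hr) ?_
    rintro rfl
    exact spectrum.zero_notMem ℝ h2 hr
  set f : ℝ → ℝ := fun r : ℝ => r ^ (-(1 / 2 : ℝ)) with hf
  have hfcont : ContinuousOn f (spectrum ℝ (star x * x)) := fun r hr =>
    (Real.continuousAt_rpow_const r _ (Or.inl (hpos r hr).ne')).continuousWithinAt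
  have hcsa : IsSelfAdjoint (cfc f (star x * x)) := cfc_predicate f _
  have hcac : cfc f (star x * x) * (star x * x) * cfc f (star x * x) = 1 := by
    have e1 : cfc f (star x * x) * cfc (fun r : ℝ => r) (star x * x) * cfc f (star x * x)
        = cfc (fun r => f r * r * f r) (star x * x) := by
      rw [cfc_mul (fun r => f r * r) f _ (hfcont.mul continuousOn_id) hfcont,
        cfc_mul f (fun r => r) _ hfcont continuousOn_id]
    rw [cfc_id' ℝ (star x * x)] at e1
    rw [e1, ← cfc_one ℝ (star x * x)]
    refine cfc_congr fun r hr => ?_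
    have hr := hpos r hr
    simp only [hf, Pi.one_apply]
    nth_rewrite 2 [← Real.rpow_one r]
    rw [← Real.rpow_add hr, ← Real.rpow_add hr]
    norm_num
  have hsu : star (x * cfc f (star x * x)) * (x * cfc f (star x * x)) = 1 := by
    rw [star_mul, hcsa.star_eq, ← hcac]; simp only [mul_assoc]
  have hcu : IsUnit (cfc f (star x * x)) := by
    refine ⟨⟨cfc f (star x * x), (star x * x) * cfc f (star x * x), by rw [← mul_assoc, hcac], ?_⟩, rfl⟩
    have hcomm : Commute (cfc f (star x * x)) (star x * x) := by
      have := cfc_commute_cfc f (fun r : ℝ => r) (star x * x)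
      rwa [cfc_id' ℝ (star x * x)] at this
    rw [← hcomm.eq, hcac]
  refine ⟨h1, h2, ?_, ?_⟩
  · rw [Unitary.mem_iff]
    refine ⟨hsu, ?_⟩
    obtain ⟨w, hw⟩ := hxu.mul hcu
    rw [← hw] at hsu ⊢
    have : star (w : A) = ↑w⁻¹ := Units.eq_inv_of_mul_eq_one_right hsu
    rw [this]; simp
  · intro η
    have hcη : Continuous (α η) := (AddMonoidHomClass.isometry_of_norm (α η) (hαn η)).continuous
    have hαx : α η x = (η : ℂ) • x := by
      let L : A →L[ℂ] A := ⟨(α η : A →ₗ[ℂ] A), hcη⟩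
      have e1 : α η x = ∫ ζ : Circle, (star (ζ : ℂ)) • (α (η * ζ) v) ∂μ := by
        have := L.integral_comp_comm hfi
        rw [← hx] at this
        refine this.symm.trans (integral_congr_ae (Filter.Eventually.of_forall fun ζ => ?_))
        change α η _ = _
        simp only [map_smul, hmul]
      have e2 : ∀ ζ : Circle, (star (ζ : ℂ)) • (α (η * ζ) v)
          = (η : ℂ) • ((star ((η * ζ : Circle) : ℂ)) • (α (η * ζ) v)) := fun ζ => by
        rw [smul_smul]
        congr 1
        rw [Circle.coe_mul, star_mul', ← mul_assoc, mul_comm (η : ℂ), hζs, one_mul]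
      rw [e1]
      simp_rw [e2]
      rw [integral_smul, integral_mul_left_eq_self (fun ζ : Circle => (star (ζ : ℂ)) • (α ζ v)) η, ← hx]
    have hαa : α η (star x * x) = star x * x := by
      rw [map_mul, map_star, hαx, star_smul, smul_mul_smul_comm, hζs, one_smul]
    have := StarAlgHomClass.map_cfc (α η) f (star x * x) hfcont hcη hsa (by rw [hαa]; exact hsa)
    rw [hαa] at this
    rw [map_mul, hαx, this, smul_mul_assoc]
end

section
/- Let A be a separable unital C*-algebra and let α be a continuous action of the circle group 𝕋 on A with the continuous Rokhlin property. Let A^α = {a ∈ A : α_ζ(a) = a for all ζ ∈ 𝕋} denote the fixed point algebra. Then there exists a family (ψ_t)_{t∈[1,∞)} of maps ψ_t : A → A such that: (i) each ψ_t is ℂ-linear, unital (ψ_t(1) = 1), star-preserving (ψ_t(a⋆) = ψ_t(a)⋆), takes values in A^α, and is completely positive, i.e. for every n ∈ ℕ and all tuples a_1,…,a_n, b_1,…,b_n ∈ A one has 0 ≤ Σ_{i,j=1}^{n} b_i⋆ · ψ_t(a_i⋆ a_j) · b_j in the canonical partial order of A; (ii) for every a ∈ A the map t ↦ ψ_t(a)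 is norm-continuous; (iii) lim_{t→∞} ‖ψ_t(ab) − ψ_t(a)ψ_t(b)‖ = 0 for all a, b ∈ A; (iv) lim_{t→∞} ‖ψ_t(a) − a‖ = 0 for every a ∈ A^α. -/
open Filter Topology

/-- The continuous Rokhlin property for a circle action on a unital C*-algebra. -/
def ContinuousRokhlin {A : Type*} [CStarAlgebra A] (α : Circle → A ≃⋆ₐ[ℂ] A) : Prop :=
  ∃ u : ℝ → A,
    ContinuousOn u (Set.Ici (1 : ℝ)) ∧
    (∀ t ∈ Set.Ici (1 : ℝ), u t ∈ unitary A) ∧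
    (∀ ε > (0 : ℝ), ∃ T : ℝ, ∀ t ≥ T, ∀ ζ : Circle, ‖α ζ (u t) - (ζ : ℂ) • u t‖ < ε) ∧
    ∀ a : A, Tendsto (fun t : ℝ => ‖u t * a - a * u t‖) atTop (𝓝 0)
open AddCircle MeasureTheory

section Helpers

variable {A : Type*} [CStarAlgebra A]

/-- The action of the circle, seen on the additive circle. -/
noncomputable def rkAct (α : Circle → A ≃⋆ₐ[ℂ] A) (x : UnitAddCircle) (a : A) : A :=
  α (AddCircle.toCircle x) a

lemma rkAct_add_arg {α : Circle → A ≃⋆ₐ[ℂ] A} (hα : IsCircleAction α) (x y : UnitAddCircle)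
    (a : A) : rkAct α (x + y) a = rkAct α x (rkAct α y a) := by
  simp [rkAct, AddCircle.toCircle_add, hα.1]

lemma rkAct_continuous {α : Circle → A ≃⋆ₐ[ℂ] A} (hα : IsCircleAction α) (a : A) :
    Continuous fun x => rkAct α x a :=
  (hα.2 a).comp AddCircle.continuous_toCircle

lemma rkAct_norm (α : Circle → A ≃⋆ₐ[ℂ] A) (x : UnitAddCircle) (a : A) :
    ‖rkAct α x a‖ = ‖a‖ := StarAlgEquiv.norm_map _ _

lemma rkAct_zero {α : Circle → A ≃⋆ₐ[ℂ] A} (hα : IsCircleAction α) (a : A) :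
    rkAct α 0 a = a := by
  have h := rkAct_add_arg hα 0 0 a
  rw [add_zero] at h
  exact ((α (AddCircle.toCircle 0)).injective h).symm

lemma rk_integrable {E : Type*} [NormedAddCommGroup E] {f : UnitAddCircle → E}
    (hf : Continuous f) : Integrable f (haarAddCircle (T := 1)) :=
  hf.integrable_of_hasCompactSupport (HasCompactSupport.of_compactSpace f)

/-- spectral projections. -/
noncomputable def rkP (α : Circle → A ≃⋆ₐ[ℂ] A) (m : ℤ) (a : A) : A :=
  ∫ x, fourier (-m) x • rkAct α x a ∂(haarAddCircle (T := 1))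

lemma rkP_cont {α : Circle → A ≃⋆ₐ[ℂ] A} (hα : IsCircleAction α) (m : ℤ) (a : A) :
    Continuous fun x : UnitAddCircle => fourier (T := 1) m x • rkAct α x a :=
  (fourier m).continuous.smul (rkAct_continuous hα a)

lemma rk_fourier_norm (m : ℤ) (x : UnitAddCircle) : ‖fourier (T := 1) m x‖ = 1 := by
  rw [fourier_apply]; exact Circle.norm_coe _

lemma rkP_add {α : Circle → A ≃⋆ₐ[ℂ] A} (hα : IsCircleAction α) (m : ℤ) (a b : A) :
    rkP α m (a + b) = rkP α m a + rkP α m b := by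
  unfold rkP
  rw [← integral_add (rk_integrable (rkP_cont hα _ _)) (rk_integrable (rkP_cont hα _ _))]
  simp [rkAct]

lemma rkP_smul (α : Circle → A ≃⋆ₐ[ℂ] A) (m : ℤ) (c : ℂ) (a : A) :
    rkP α m (c • a) = c • rkP α m a := by
  unfold rkP
  rw [← integral_smul]
  simp [rkAct, smul_comm c]

lemma rkP_norm_le (α : Circle → A ≃⋆ₐ[ℂ] A) (m : ℤ) (a : A) : ‖rkP α m a‖ ≤ ‖a‖ := by
  refine (norm_integral_le_of_norm_le_const (C := ‖a‖) (Filter.Eventually.of_forall fun x => ?_)).trans ?_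
  · rw [norm_smul, rk_fourier_norm, rkAct_norm, one_mul]
  · simp

/-- spectral projection as a linear map. -/
noncomputable def rkPL {α : Circle → A ≃⋆ₐ[ℂ] A} (hα : IsCircleAction α) (m : ℤ) : A →L[ℂ] A :=
  LinearMap.mkContinuous ⟨⟨rkP α m, rkP_add hα m⟩, rkP_smul α m⟩ 1
    (fun a => by simpa using rkP_norm_le α m a)

@[simp] lemma rkPL_apply {α : Circle → A ≃⋆ₐ[ℂ] A} (hα : IsCircleAction α) (m : ℤ) (a : A) :
    rkPL hα m a = rkP α m a := rfl

lemma rkP_eq_fourierCoeff (α : Circle → A ≃⋆ₐ[ℂ] A) (m : ℤ) (a : A) :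
    rkP α m a = fourierCoeff (fun x : UnitAddCircle => rkAct α x a) m := rfl

/-- a star automorphism as a continuous linear map -/
noncomputable def rkL (φ : A ≃⋆ₐ[ℂ] A) : A →L[ℂ] A :=
  LinearMap.mkContinuous ⟨⟨φ, map_add φ⟩, map_smul φ⟩ 1
    (fun a => by simpa using (StarAlgEquiv.norm_map φ a).le)

@[simp] lemma rkL_apply (φ : A ≃⋆ₐ[ℂ] A) (a : A) : rkL φ a = φ a := rfl

lemma rk_map_integral (φ : A ≃⋆ₐ[ℂ] A) {f : UnitAddCircle → A} (hf : Continuous f) :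
    φ (∫ x, f x ∂haarAddCircle) = ∫ x, φ (f x) ∂haarAddCircle :=
  ((rkL φ).integral_comp_comm (rk_integrable hf)).symm

lemma rkAct_rkP {α : Circle → A ≃⋆ₐ[ℂ] A} (hα : IsCircleAction α) (m : ℤ) (a : A)
    (y : UnitAddCircle) : rkAct α y (rkP α m a) = fourier m y • rkP α m a := by
  conv_lhs => rw [rkAct, rkP, rk_map_integral _ (rkP_cont hα _ _)]
  rw [rkP, ← integral_smul, ← integral_add_left_eq_self
    (fun x => fourier m y • fourier (-m) x • rkAct α x a) y]
  congr 1
  ext x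
  rw [map_smul, smul_smul, rkAct_add_arg hα]
  congr 1
  simp only [fourier_apply, smul_add, toCircle_add]
  rw [← Circle.coe_mul, ← mul_assoc, ← toCircle_add]
  simp

lemma rk_surj (ζ : Circle) : ∃ x : UnitAddCircle, AddCircle.toCircle x = ζ :=
  (AddCircle.homeomorphCircle one_ne_zero).surjective ζ |>.imp fun x hx => by
    rwa [AddCircle.homeomorphCircle_apply] at hx

lemma rk_integral_fourier (m : ℤ) :
    ∫ x, fourier (T := 1) m x ∂haarAddCircle = if m = 0 then 1 else 0 := by
  split_ifs with h
  · subst h; simp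
  · exact integral_eq_zero_of_add_right_eq_neg
      (fun x => fourier_add_half_inv_index h one_pos x)

/-- homogeneous elements -/
def rkHom (α : Circle → A ≃⋆ₐ[ℂ] A) (m : ℤ) (a : A) : Prop :=
  ∀ x : UnitAddCircle, rkAct α x a = fourier m x • a

lemma rkP_of_hom {α : Circle → A ≃⋆ₐ[ℂ] A} {m : ℤ} {a : A} (h : rkHom α m a) (k : ℤ) :
    rkP α k a = if k = m then a else 0 := by
  unfold rkP
  simp_rw [h _, smul_smul, ← fourier_add]
  rw [integral_smul_const, rk_integral_fourier]
  by_cases hk : k = m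
  · simp [hk]
  · rw [if_neg (by lia), if_neg hk, zero_smul]

lemma rkHom_one (α : Circle → A ≃⋆ₐ[ℂ] A) : rkHom α 0 (1 : A) := by
  intro x; simp [rkAct]

lemma rkHom_mul {α : Circle → A ≃⋆ₐ[ℂ] A} {m k : ℤ} {a b : A} (ha : rkHom α m a)
    (hb : rkHom α k b) : rkHom α (m + k) (a * b) := by
  intro x
  have h1 := ha x
  have h2 := hb x
  unfold rkAct at *
  rw [map_mul, h1, h2, fourier_add, smul_mul_smul_comm]

lemma rkP_star (α : Circle → A ≃⋆ₐ[ℂ] A) (m : ℤ) (a : A) :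
    star (rkP α m a) = rkP α (-m) (star a) := by
  unfold rkP
  have := ((starL' ℝ : A ≃L[ℝ] A)).integral_comp_comm (μ := haarAddCircle (T := 1))
    (fun x : UnitAddCircle => fourier (T := 1) (-m) x • rkAct α x a)
  simp only [starL'_apply] at this
  rw [← this]
  congr 1
  ext x
  rw [star_smul, fourier_neg (n := -m)]
  simp [rkAct, map_star]

/-- the spectral subspaces span a dense subspace -/
lemma rk_dense {α : Circle → A ≃⋆ₐ[ℂ] A} (hα : IsCircleAction α) (M : Submodule ℂ A)
    (hM : IsClosed (M : Set A)) (h : ∀ m a, rkP α m a ∈ M) (a : A) : a ∈ M := by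
  have : IsClosed (M : Set A) := hM
  rw [← Submodule.Quotient.mk_eq_zero]
  refine SeparatingDual.eq_zero_of_forall_dual_eq_zero (R := ℂ) fun f => ?_
  let q : A →L[ℂ] A ⧸ M := M.mkQL
  let g : A →L[ℂ] ℂ := f.comp q
  let F : C(UnitAddCircle, ℂ) := ⟨fun x => g (rkAct α x a), g.continuous.comp (rkAct_continuous hα a)⟩
  have hF : fourierCoeff F = 0 := by
    ext m
    have h1 : g (rkP α m a) = fourierCoeff F m := by
      rw [rkP, ← g.integral_comp_comm (rk_integrable (rkP_cont hα _ _))]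
      simp [fourierCoeff, F]
    rw [← h1]
    have : q (rkP α m a) = 0 := (Submodule.Quotient.mk_eq_zero M).2 (h m a)
    simp [g, this]
  have hs := has_pointwise_sum_fourier_series_of_summable (f := F) (by rw [hF]; exact summable_zero) 0
  rw [hF] at hs
  have h0 : F 0 = 0 := hs.unique (by simp)
  have : F 0 = g a := by simp [F, rkAct_zero hα]
  rw [this] at h0
  exact h0

lemma rk_mul_rkP_mul {α : Circle → A ≃⋆ₐ[ℂ] A} (hα : IsCircleAction α) (m : ℤ) (y a z : A) :
    y * rkP α m a * z = ∫ x, fourier (-m) x • (y * rkAct α x a * z) ∂(haarAddCircle (T := 1)) := by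
  have h := ((ContinuousLinearMap.mul ℂ A).flip z ∘L (ContinuousLinearMap.mul ℂ A y)).integral_comp_comm
    (rk_integrable (rkP_cont hα (-m) a))
  simp only [ContinuousLinearMap.comp_apply, ContinuousLinearMap.flip_apply,
    ContinuousLinearMap.mul_apply', mul_smul_comm, smul_mul_assoc] at h
  rw [rkP, ← h]

lemma rk_cont_mul {α : Circle → A ≃⋆ₐ[ℂ] A} (hα : IsCircleAction α) (m : ℤ) (y a z : A) :
    Continuous fun x : UnitAddCircle => fourier (T := 1) m x • (y * rkAct α x a * z) :=
  (fourier m).continuous.smul ((continuous_const.mul (rkAct_continuous hα a)).mul continuous_const)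

/-- The Fejer-type map. -/
noncomputable def rkTh (α : Circle → A ≃⋆ₐ[ℂ] A) (N : ℕ) (u : unitary A) (a : A) : A :=
  (N : ℝ)⁻¹ • ∑ k ∈ Finset.range N, ∑ l ∈ Finset.range N,
    (u : A) ^ k * rkP α ((l : ℤ) - k) a * star (u : A) ^ l

/-- The averaged map. -/
noncomputable def rkPsi (α : Circle → A ≃⋆ₐ[ℂ] A) (N : ℕ) (u : unitary A) (a : A) : A :=
  rkP α 0 (rkTh α N u a)

/-- unital completely positive maps to the fixed point algebra -/
structure RkUCP [PartialOrder A] (α : Circle → A ≃⋆ₐ[ℂ] A) (φ : A → A) : Prop where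
  lin : IsLinearMap ℂ φ
  one : φ 1 = 1
  star : ∀ a : A, φ (star a) = star (φ a)
  fix : ∀ a : A, ∀ ζ : Circle, α ζ (φ a) = φ a
  cp : ∀ n : ℕ, ∀ a b : Fin n → A,
          0 ≤ ∑ i : Fin n, ∑ j : Fin n, Star.star (b i) * φ (Star.star (a i) * a j) * b j

lemma rkTh_lin {α : Circle → A ≃⋆ₐ[ℂ] A} (hα : IsCircleAction α) (N : ℕ) (u : unitary A) :
    IsLinearMap ℂ (rkTh α N u) := by
  constructor
  · intro a b
    simp only [rkTh, rkP_add hα, mul_add, add_mul, Finset.sum_add_distrib, smul_add]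
  · intro c a
    simp only [rkTh, rkP_smul, mul_smul_comm, smul_mul_assoc, ← Finset.smul_sum]
    rw [smul_comm]

lemma rkTh_one (α : Circle → A ≃⋆ₐ[ℂ] A) {N : ℕ} (hN : 0 < N) (u : unitary A) :
    rkTh α N u 1 = 1 := by
  have : ∀ k ∈ Finset.range N, ∑ l ∈ Finset.range N,
      (u : A) ^ k * rkP α ((l : ℤ) - k) 1 * star (u : A) ^ l = 1 := by
    intro k hk
    rw [Finset.sum_eq_single_of_mem k hk]
    · rw [rkP_of_hom (rkHom_one α), if_pos (by simp), mul_one, ← star_pow]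
      have := (u ^ k).2
      exact Unitary.mul_star_self_of_mem this
    · intro l _ hl
      rw [rkP_of_hom (rkHom_one α), if_neg (by lia)]
      simp
  rw [rkTh, Finset.sum_congr rfl this]
  simp only [Finset.sum_const, Finset.card_range]
  rw [← Nat.cast_smul_eq_nsmul ℝ, smul_smul, inv_mul_cancel₀ (by positivity), one_smul]

lemma rkTh_star (α : Circle → A ≃⋆ₐ[ℂ] A) (N : ℕ) (u : unitary A) (a : A) :
    rkTh α N u (star a) = star (rkTh α N u a) := by
  simp only [rkTh, star_smul, star_sum, star_mul, star_pow, star_star, rkP_star, star_trivial]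
  rw [Finset.sum_comm]
  simp only [neg_sub, mul_assoc]

lemma rkTh_cp [PartialOrder A] [StarOrderedRing A] {α : Circle → A ≃⋆ₐ[ℂ] A}
    (hα : IsCircleAction α) (N : ℕ) (u : unitary A) (n : ℕ) (a b : Fin n → A) :
    0 ≤ ∑ i : Fin n, ∑ j : Fin n, star (b i) * rkTh α N u (star (a i) * a j) * b j := by
  let c : UnitAddCircle → A := fun x => ∑ j : Fin n, ∑ l ∈ Finset.range N,
    fourier (T := 1) (-(l : ℤ)) x • (rkAct α x (a j) * star (u : A) ^ l * b j)
  have hc : ∀ x, star (c x) * c x = ∑ i : Fin n, ∑ j : Fin n, ∑ k ∈ Finset.range N,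
      ∑ l ∈ Finset.range N, fourier (T := 1) (-((l : ℤ) - k)) x •
        ((star (b i) * (u : A) ^ k) * rkAct α x (star (a i) * a j) * (star (u : A) ^ l * b j)) := by
    intro x
    simp only [c, star_sum, Finset.sum_mul_sum]
    refine Finset.sum_congr rfl fun i _ => ?_
    refine Finset.sum_congr rfl fun j _ => ?_
    refine Finset.sum_congr rfl fun k _ => ?_
    refine Finset.sum_congr rfl fun l _ => ?_
    rw [star_smul, smul_mul_smul_comm, show (-((l : ℤ) - k)) = k + -l by ring, fourier_add,
      fourier_neg (n := (k : ℤ))]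
    simp [rkAct, mul_assoc, map_star]
  have h : ∑ i : Fin n, ∑ j : Fin n, star (b i) * rkTh α N u (star (a i) * a j) * b j =
      (N : ℝ)⁻¹ • ∫ x, star (c x) * c x ∂(haarAddCircle (T := 1)) := by
    simp_rw [hc]
    have hi := fun (i j : Fin n) (k l : ℕ) => rk_integrable (rk_cont_mul hα (-((l : ℤ) - k))
      (star (b i) * (u : A) ^ k) (star (a i) * a j) (star (u : A) ^ l * b j))
    rw [integral_finsetSum _ (fun i _ => integrable_finsetSum _ fun j _ =>
      integrable_finsetSum _ fun k _ => integrable_finsetSum _ fun l _ => hi i j k l),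
      Finset.smul_sum]
    refine Finset.sum_congr rfl fun i _ => ?_
    rw [integral_finsetSum _ (fun j _ =>
      integrable_finsetSum _ fun k _ => integrable_finsetSum _ fun l _ => hi i j k l),
      Finset.smul_sum]
    refine Finset.sum_congr rfl fun j _ => ?_
    rw [integral_finsetSum _ (fun k _ => integrable_finsetSum _ fun l _ => hi i j k l),
      rkTh, mul_smul_comm, smul_mul_assoc, Finset.mul_sum, Finset.sum_mul]
    congr 1
    refine Finset.sum_congr rfl fun k _ => ?_
    rw [integral_finsetSum _ (fun l _ => hi i j k l), Finset.mul_sum, Finset.sum_mul]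
    refine Finset.sum_congr rfl fun l _ => ?_
    rw [← rk_mul_rkP_mul hα]
    simp only [mul_assoc]
  rw [h]
  exact smul_nonneg (by positivity) (integral_nonneg fun x => star_mul_self_nonneg _)

lemma rkPsi_ucp [PartialOrder A] [StarOrderedRing A] {α : Circle → A ≃⋆ₐ[ℂ] A}
    (hα : IsCircleAction α) {N : ℕ} (hN : 0 < N) (u : unitary A) : RkUCP α (rkPsi α N u) where
  lin := by
    constructor
    · intro a b; simp only [rkPsi, (rkTh_lin hα N u).map_add, rkP_add hα]
    · intro a b; simp only [rkPsi, (rkTh_lin hα N u).map_smul, rkP_smul]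
  one := by rw [rkPsi, rkTh_one α hN, rkP_of_hom (rkHom_one α), if_pos rfl]
  star a := by rw [rkPsi, rkTh_star, rkPsi, rkP_star, neg_zero]
  fix a ζ := by
    obtain ⟨x, rfl⟩ := rk_surj ζ
    have := rkAct_rkP hα 0 (rkTh α N u a) x
    simpa [rkAct, rkPsi] using this
  cp n a b := by
    simp only [rkPsi]
    have : ∑ i : Fin n, ∑ j : Fin n, star (b i) * rkP α 0 (rkTh α N u (star (a i) * a j)) * b j =
      ∫ x, ∑ i : Fin n, ∑ j : Fin n, fourier (-0) x • (star (b i) *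
        rkAct α x (rkTh α N u (star (a i) * a j)) * b j) ∂(haarAddCircle (T := 1)) := by
      have hi := fun (i j : Fin n) => rk_integrable (rk_cont_mul hα (-0)
        (star (b i)) (rkTh α N u (star (a i) * a j)) (b j))
      rw [integral_finsetSum _ (fun i _ => integrable_finsetSum _ fun j _ => hi i j)]
      refine Finset.sum_congr rfl fun i _ => ?_
      rw [integral_finsetSum _ (fun j _ => hi i j)]
      refine Finset.sum_congr rfl fun j _ => ?_
      rw [← rk_mul_rkP_mul hα]
    rw [this]
    refine integral_nonneg fun x => ?_
    have h := rkTh_cp hα N u n a (fun i => (α (toCircle x)).symm (b i))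
    have h2 := map_nonneg (α (toCircle x)) h
    simpa [rkAct, map_star] using h2

lemma RkUCP.norm_le [PartialOrder A] [StarOrderedRing A] [Nontrivial A]
    {α : Circle → A ≃⋆ₐ[ℂ] A} {φ : A → A} (h : RkUCP α φ) (a : A) : ‖φ a‖ ≤ 6 * ‖a‖ := by
  have hpos : ∀ a, 0 ≤ a → 0 ≤ φ a := by
    intro a ha
    obtain ⟨b, rfl⟩ := CStarAlgebra.nonneg_iff_eq_star_mul_self.1 ha
    simpa using h.cp 1 (fun _ => b) (fun _ => 1)
  let f : A →ₚ[ℂ] A := PositiveLinearMap.mk₀ (h.lin.mk') (fun a ha => hpos a ha)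
  have hf : ∀ a, f a = φ a := fun a => rfl
  have hn : ∀ a, 0 ≤ a → ‖φ a‖ ≤ ‖a‖ := by
    intro a ha
    have := f.norm_apply_le_of_nonneg a ha
    rwa [hf, hf, h.one, norm_one, one_mul] at this
  have hs : ∀ a, IsSelfAdjoint a → ‖φ a‖ ≤ 3 * ‖a‖ := by
    intro a ha
    have h1 : 0 ≤ a + ((‖a‖ : ℝ) : ℂ) • (1 : A) := by
      have := ha.neg_algebraMap_norm_le_self
      rw [← sub_nonneg, sub_neg_eq_add, Algebra.algebraMap_eq_smul_one] at this
      exact this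
    have h2 := hn _ h1
    rw [h.lin.map_add, h.lin.map_smul, h.one] at h2
    have h3 : ‖((‖a‖ : ℝ) : ℂ) • (1 : A)‖ = ‖a‖ := by rw [norm_smul]; simp
    have h4 := norm_add_le a (((‖a‖ : ℝ) : ℂ) • (1 : A))
    have h5 := norm_sub_le (φ a + ((‖a‖ : ℝ) : ℂ) • (1 : A)) (((‖a‖ : ℝ) : ℂ) • (1 : A))
    rw [add_sub_cancel_right] at h5
    linarith
  have hd := realPart_add_I_smul_imaginaryPart a
  have h1 := hs _ (realPart a).2
  have h2 := hs _ (imaginaryPart a).2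
  have h3 : ‖(realPart a : A)‖ ≤ ‖a‖ := realPart.norm_le a
  have h4 : ‖(imaginaryPart a : A)‖ ≤ ‖a‖ := imaginaryPart.norm_le a
  have h5 : φ a = φ (realPart a : A) + Complex.I • φ (imaginaryPart a : A) := by
    rw [← h.lin.map_smul, ← h.lin.map_add, hd]
  have h6 := norm_add_le (φ (realPart a : A)) (Complex.I • φ (imaginaryPart a : A))
  rw [norm_smul, Complex.norm_I, one_mul] at h6
  rw [h5]
  linarith

lemma rkUCP_convex [PartialOrder A] [StarOrderedRing A] (α : Circle → A ≃⋆ₐ[ℂ] A) :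
    Convex ℝ {φ : A → A | RkUCP α φ} := by
  intro φ hφ ψ hψ s t hs ht hst
  simp only [Set.mem_ofPred_eq] at *
  have hr : ∀ (r : ℝ) (a : A), r • a = (r : ℂ) • a := fun r a => rfl
  refine ⟨⟨?_, ?_⟩, ?_, ?_, ?_, ?_⟩
  · intro a b
    simp only [Pi.add_apply, Pi.smul_apply, hφ.lin.map_add, hψ.lin.map_add, smul_add]
    abel
  · intro c a
    simp only [Pi.add_apply, Pi.smul_apply, hφ.lin.map_smul, hψ.lin.map_smul, smul_add]
    rw [smul_comm, smul_comm t]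
  · simp only [Pi.add_apply, Pi.smul_apply, hφ.one, hψ.one]
    rw [← add_smul, hst, one_smul]
  · intro a
    simp only [Pi.add_apply, Pi.smul_apply, hφ.star, hψ.star, star_add, star_smul, star_trivial]
  · intro a ζ
    simp only [Pi.add_apply, Pi.smul_apply, hr, map_add, map_smul, hφ.fix, hψ.fix]
  · intro n a b
    have h1 := smul_nonneg hs (hφ.cp n a b)
    have h2 := smul_nonneg ht (hψ.cp n a b)
    convert! add_nonneg h1 h2 using 1
    simp only [Pi.add_apply, Pi.smul_apply, mul_add, add_mul, Finset.sum_add_distrib,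
      Finset.smul_sum, mul_smul_comm, smul_mul_assoc]

lemma rkPsi_cont {α : Circle → A ≃⋆ₐ[ℂ] A} (hα : IsCircleAction α) (N : ℕ) (a : A)
    {v : ℝ → unitary A} (hv : Continuous v) : Continuous fun t => rkPsi α N (v t) a := by
  have h : Continuous fun t => (v t : A) := continuous_subtype_val.comp hv
  have h2 : Continuous fun t => rkTh α N (v t) a := by
    unfold rkTh
    fun_prop
  exact (rkPL hα 0).continuous.comp h2

/-- integer powers of a unitary -/
noncomputable def rkW (m : ℤ) (u : unitary A) : A := ((u ^ (-m) : unitary A) : A)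

lemma rkW_zero (u : unitary A) : rkW 0 u = 1 := by simp [rkW]

lemma rkW_add (m k : ℤ) (u : unitary A) : rkW (m + k) u = rkW m u * rkW k u := by
  rw [rkW, neg_add, zpow_add]; rfl

lemma rkW_nat (n : ℕ) (u : unitary A) : rkW (n : ℤ) u = star (u : A) ^ n := by
  rw [rkW, zpow_neg, zpow_natCast, ← inv_pow]; rfl

lemma rkW_neg (n : ℕ) (u : unitary A) : rkW (-(n : ℤ)) u = (u : A) ^ n := by
  simp [rkW]

lemma rk_norm_mul_W (a : A) (m : ℤ) (u : unitary A) : ‖a * rkW m u‖ = ‖a‖ :=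
  CStarRing.norm_mul_coe_unitary a _

lemma rk_norm_W_mul (a : A) (m : ℤ) (u : unitary A) : ‖rkW m u * a‖ = ‖a‖ :=
  CStarRing.norm_coe_unitary_mul _ a

lemma rk_comm_pow (u : unitary A) (a : A) (k : ℕ) :
    ‖(u : A) ^ k * a - a * (u : A) ^ k‖ ≤ k * ‖(u : A) * a - a * u‖ := by
  induction k with
  | zero => simp
  | succ k ih =>
    have h : (u : A) ^ (k + 1) * a - a * (u : A) ^ (k + 1) =
        ((u ^ k : unitary A) : A) * ((u : A) * a - a * u)
          + ((u : A) ^ k * a - a * (u : A) ^ k) * (u : A) := by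
      simp only [SubmonoidClass.coe_pow, pow_succ]
      noncomm_ring
    rw [h]
    refine (norm_add_le _ _).trans ?_
    rw [CStarRing.norm_coe_unitary_mul, CStarRing.norm_mul_coe_unitary]
    push_cast
    linarith

lemma rk_comm_W (u : unitary A) (a : A) (m : ℤ) :
    ‖rkW m u * a - a * rkW m u‖ ≤ |(m : ℝ)| * ‖(u : A) * a - a * u‖ := by
  obtain ⟨n, rfl | rfl⟩ := m.eq_nat_or_neg
  · have h : rkW (-(n : ℤ)) u * (rkW (n : ℤ) u * a - a * rkW (n : ℤ) u) * rkW (-(n : ℤ)) u =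
        - ((u : A) ^ n * a - a * (u : A) ^ n) := by
      have h1 : rkW (-(n : ℤ)) u * rkW (n : ℤ) u = 1 := by
        rw [← rkW_add, neg_add_cancel, rkW_zero]
      have h2 : rkW (n : ℤ) u * rkW (-(n : ℤ)) u = 1 := by
        rw [← rkW_add, add_neg_cancel, rkW_zero]
      rw [← rkW_neg, mul_sub, sub_mul, ← mul_assoc, h1, one_mul, mul_assoc, mul_assoc a, h2,
        mul_one, neg_sub]
    rw [← rk_norm_W_mul _ (-(n : ℤ)) u, ← rk_norm_mul_W _ (-(n : ℤ)) u, h, norm_neg]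
    simpa using rk_comm_pow u a n
  · rw [rkW_neg]
    simpa using rk_comm_pow u a n

lemma rk_act_pow (α : Circle → A ≃⋆ₐ[ℂ] A) (u : unitary A) (x : UnitAddCircle) (n : ℕ) :
    ‖rkAct α x ((u : A) ^ n) - fourier (n : ℤ) x • (u : A) ^ n‖ ≤
      n * ‖rkAct α x (u : A) - fourier 1 x • (u : A)‖ := by
  induction n with
  | zero => simp [rkAct]
  | succ n ih =>
    have h : rkAct α x ((u : A) ^ (n + 1)) - fourier ((n + 1 : ℕ) : ℤ) x • (u : A) ^ (n + 1) =
        rkAct α x ((u ^ n : unitary A) : A) * (rkAct α x (u : A) - fourier 1 x • (u : A)) +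
        fourier 1 x • ((rkAct α x ((u : A) ^ n) - fourier (n : ℤ) x • (u : A) ^ n) * (u : A)) := by
      have h1 : rkAct α x ((u : A) ^ (n + 1)) = rkAct α x ((u : A) ^ n) * rkAct α x (u : A) := by
        simp [rkAct, pow_succ]
      rw [h1, Nat.cast_add, Nat.cast_one, fourier_add, pow_succ]
      simp only [SubmonoidClass.coe_pow, mul_sub, sub_mul, smul_sub, mul_smul_comm, smul_mul_assoc,
        smul_smul]
      rw [mul_comm (fourier (n : ℤ) x)]
      abel
    have h3 : ‖rkAct α x ((u ^ n : unitary A) : A) * (rkAct α x (u : A) - fourier 1 x • (u : A))‖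
        = ‖rkAct α x (u : A) - fourier 1 x • (u : A)‖ := by
      have hm : rkAct α x ((u ^ n : unitary A) : A) ∈ unitary A :=
        Unitary.map_mem (α (toCircle x)) (u ^ n).2
      exact CStarRing.norm_coe_unitary_mul ⟨_, hm⟩ _
    rw [h]
    refine (norm_add_le _ _).trans ?_
    rw [h3, norm_smul, rk_fourier_norm, one_mul, CStarRing.norm_mul_coe_unitary]
    push_cast
    linarith

lemma rk_act_W (α : Circle → A ≃⋆ₐ[ℂ] A) (u : unitary A) (x : UnitAddCircle) (m : ℤ) :
    ‖rkAct α x (rkW m u) - fourier (-m) x • rkW m u‖ ≤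
      |(m : ℝ)| * ‖rkAct α x (u : A) - fourier 1 x • (u : A)‖ := by
  obtain ⟨n, rfl | rfl⟩ := m.eq_nat_or_neg
  · have h := rk_act_pow α u x n
    rw [← norm_star, star_sub, star_smul] at h
    rw [rkW_nat, fourier_neg]
    simpa [rkAct, map_star] using h
  · rw [rkW_neg]
    simpa using rk_act_pow α u x n

lemma rk_card (N : ℕ) (m : ℤ) :
    ((Finset.range N).filter (fun k : ℕ => ¬ (0 ≤ (k : ℤ) + m ∧ (k : ℤ) + m < N))).card
      ≤ m.natAbs := by
  rcases le_total 0 m with h | h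
  · calc _ ≤ (Finset.Ico (N - m.natAbs) N).card := Finset.card_le_card (fun k hk => by
          simp only [Finset.mem_filter, Finset.mem_range, Finset.mem_Ico] at hk ⊢; lia)
      _ ≤ _ := by rw [Nat.card_Ico]; lia
  · calc _ ≤ (Finset.range m.natAbs).card := Finset.card_le_card (fun k hk => by
          simp only [Finset.mem_filter, Finset.mem_range] at hk ⊢; lia)
      _ ≤ _ := by simp

lemma rkTh_est {α : Circle → A ≃⋆ₐ[ℂ] A} {m : ℤ} {a : A}
    (ha : rkHom α m a) {N : ℕ} (hN : 0 < N) (u : unitary A) :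
    ‖rkTh α N u a - a * rkW m u‖ ≤ N * ‖(u : A) * a - a * u‖ + (N : ℝ)⁻¹ * (|(m : ℝ)| * ‖a‖) := by
  have hN' : (0 : ℝ) < N := by exact_mod_cast hN
  set γ := ‖(u : A) * a - a * u‖ with hγ
  have e : rkTh α N u a - a * rkW m u = (N : ℝ)⁻¹ • ∑ k ∈ Finset.range N,
      ((∑ l ∈ Finset.range N, (u : A) ^ k * rkP α ((l : ℤ) - k) a * star (u : A) ^ l)
        - a * rkW m u) := by
    rw [Finset.sum_sub_distrib, smul_sub, rkTh]
    congr 1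
    simp only [Finset.sum_const, Finset.card_range]
    rw [← Nat.cast_smul_eq_nsmul ℝ, smul_smul, inv_mul_cancel₀ hN'.ne', one_smul]
  have key : ∀ k ∈ Finset.range N,
      ‖(∑ l ∈ Finset.range N, (u : A) ^ k * rkP α ((l : ℤ) - k) a * star (u : A) ^ l)
        - a * rkW m u‖ ≤ N * γ + if ¬ (0 ≤ (k : ℤ) + m ∧ (k : ℤ) + m < N) then ‖a‖ else 0 := by
    intro k hk
    rw [Finset.mem_range] at hk
    by_cases hc : ¬ (0 ≤ (k : ℤ) + m ∧ (k : ℤ) + m < N)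
    · rw [if_pos hc, Finset.sum_eq_zero, zero_sub, norm_neg, rk_norm_mul_W]
      · have : 0 ≤ N * γ := by positivity
        linarith
      · intro l hl
        rw [Finset.mem_range] at hl
        rw [rkP_of_hom ha, if_neg (by lia)]
        simp
    · rw [if_neg hc]
      have hc := not_not.1 hc
      obtain ⟨l, hl⟩ := Int.eq_ofNat_of_zero_le hc.1
      rw [Finset.sum_eq_single_of_mem l (by rw [Finset.mem_range]; lia)]
      · rw [rkP_of_hom ha, if_pos (by lia), show m = -(k : ℤ) + l by lia, rkW_add, rkW_neg,
          ← rkW_nat, ← mul_assoc, ← sub_mul, rk_norm_mul_W, add_zero]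
        refine (rk_comm_pow u a k).trans ?_
        have : (k : ℝ) ≤ N := by exact_mod_cast hk.le
        gcongr
      · intro l' _ hne
        rw [rkP_of_hom ha, if_neg (by lia)]
        simp
  rw [e, norm_smul, norm_inv, Real.norm_natCast]
  calc (N : ℝ)⁻¹ * _ ≤ (N : ℝ)⁻¹ * (N * (N * γ) + |(m : ℝ)| * ‖a‖) := by
        gcongr
        refine (norm_sum_le _ _).trans ((Finset.sum_le_sum key).trans ?_)
        rw [Finset.sum_add_distrib, ← Finset.sum_filter]
        simp only [Finset.sum_const, Finset.card_range, nsmul_eq_mul]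
        gcongr
        have := rk_card N m
        have h2 : ((m.natAbs : ℕ) : ℝ) = |(m : ℝ)| := by
          rw [← Int.cast_abs, Int.abs_eq_natAbs]; rfl
        rw [← h2]
        exact_mod_cast this
    _ = _ := by field_simp

lemma rkP_zero_est {α : Circle → A ≃⋆ₐ[ℂ] A} (hα : IsCircleAction α) (y : A) (δ : ℝ)
    (h : ∀ x : UnitAddCircle, ‖rkAct α x y - y‖ ≤ δ) : ‖rkP α 0 y - y‖ ≤ δ := by
  have e : rkP α 0 y - y = ∫ x, (rkAct α x y - y) ∂(haarAddCircle (T := 1)) := by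
    rw [integral_sub (rk_integrable (rkAct_continuous hα y)) (rk_integrable continuous_const)]
    simp [rkP]
  rw [e]
  refine (norm_integral_le_of_norm_le_const (C := δ) (Filter.Eventually.of_forall h)).trans ?_
  simp

lemma rkPsi_est {α : Circle → A ≃⋆ₐ[ℂ] A} (hα : IsCircleAction α) {m : ℤ} {a : A}
    (ha : rkHom α m a) {N : ℕ} (hN : 0 < N) (u : unitary A) (δ : ℝ)
    (hδ : ∀ x : UnitAddCircle, ‖rkAct α x (u : A) - fourier 1 x • (u : A)‖ ≤ δ) :
    ‖rkPsi α N u a - a * rkW m u‖ ≤ N * ‖(u : A) * a - a * u‖ + (N : ℝ)⁻¹ * (|(m : ℝ)| * ‖a‖)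
      + |(m : ℝ)| * ‖a‖ * δ := by
  have h1 : ‖rkPsi α N u a - rkP α 0 (a * rkW m u)‖ ≤
      N * ‖(u : A) * a - a * u‖ + (N : ℝ)⁻¹ * (|(m : ℝ)| * ‖a‖) := by
    have : rkPsi α N u a - rkP α 0 (a * rkW m u) = rkP α 0 (rkTh α N u a - a * rkW m u) := by
      simp only [rkPsi, ← rkPL_apply hα, map_sub]
    rw [this]
    exact (rkP_norm_le α 0 _).trans (rkTh_est ha hN u)
  have h2 : ‖rkP α 0 (a * rkW m u) - a * rkW m u‖ ≤ |(m : ℝ)| * ‖a‖ * δ := by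
    refine rkP_zero_est hα _ _ fun x => ?_
    have e : rkAct α x (a * rkW m u) - a * rkW m u =
        fourier m x • (a * (rkAct α x (rkW m u) - fourier (-m) x • rkW m u)) := by
      have : rkAct α x (a * rkW m u) = rkAct α x a * rkAct α x (rkW m u) := by simp [rkAct]
      rw [this, ha x, mul_sub, smul_sub, mul_smul_comm, smul_smul, ← fourier_add, add_neg_cancel,
        fourier_zero, one_smul, smul_mul_assoc]
    rw [e, norm_smul, rk_fourier_norm, one_mul]
    calc _ ≤ ‖a‖ * (|(m : ℝ)| * δ) := by
          refine (norm_mul_le _ _).trans ?_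
          gcongr
          exact (rk_act_W α u x m).trans (by gcongr; exact hδ x)
      _ = _ := by ring
  calc _ ≤ _ := norm_sub_le_norm_sub_add_norm_sub _ (rkP α 0 (a * rkW m u)) _
    _ ≤ _ := add_le_add h1 h2

lemma rkPsi_eventually {α : Circle → A ≃⋆ₐ[ℂ] A} (hα : IsCircleAction α) {m : ℤ} {a : A}
    (ha : rkHom α m a) {v : ℝ → unitary A}
    (h1 : ∀ ε > (0 : ℝ), ∀ᶠ t in atTop, ∀ x : UnitAddCircle,
      ‖rkAct α x (v t : A) - fourier 1 x • (v t : A)‖ ≤ ε)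
    (h2 : ∀ a : A, Tendsto (fun t : ℝ => ‖(v t : A) * a - a * v t‖) atTop (𝓝 0))
    {ε : ℝ} (hε : 0 < ε) :
    ∀ᶠ N : ℕ in atTop, ∀ᶠ t in atTop, ‖rkPsi α N (v t) a - a * rkW m (v t)‖ ≤ ε := by
  have l1 : Tendsto (fun N : ℕ => (N : ℝ)⁻¹ * (|(m : ℝ)| * ‖a‖)) atTop (𝓝 0) := by
    simpa using (tendsto_inv_atTop_nhds_zero_nat (𝕜 := ℝ)).mul_const (|(m : ℝ)| * ‖a‖)
  filter_upwards [l1.eventually (eventually_le_nhds (show 0 < ε / 3 by positivity)),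
    eventually_gt_atTop 0] with N hN1 hN
  have l2 : Tendsto (fun t : ℝ => (N : ℝ) * ‖(v t : A) * a - a * v t‖) atTop (𝓝 0) := by
    simpa using (h2 a).const_mul (N : ℝ)
  have hC : 0 ≤ |(m : ℝ)| * ‖a‖ := by positivity
  filter_upwards [l2.eventually (eventually_le_nhds (show 0 < ε / 3 by positivity)),
    h1 (ε / 3 / (|(m : ℝ)| * ‖a‖ + 1)) (by positivity)] with t ht1 ht2
  have := rkPsi_est hα ha hN (v t) _ ht2
  have h3 : |(m : ℝ)| * ‖a‖ * (ε / 3 / (|(m : ℝ)| * ‖a‖ + 1)) ≤ ε / 3 := by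
    rw [mul_div_assoc', div_le_iff₀ (by positivity)]
    nlinarith
  linarith

lemma rk_select [PartialOrder A] [StarOrderedRing A] {α : Circle → A ≃⋆ₐ[ℂ] A}
    (hα : IsCircleAction α) {v : ℝ → unitary A} (hv : Continuous v)
    (h1 : ∀ ε > (0 : ℝ), ∀ᶠ t in atTop, ∀ x : UnitAddCircle,
      ‖rkAct α x (v t : A) - fourier 1 x • (v t : A)‖ ≤ ε)
    (h2 : ∀ a : A, Tendsto (fun t : ℝ => ‖(v t : A) * a - a * v t‖) atTop (𝓝 0))
    (d : ℕ → A) (m : ℕ → ℤ) (hd : ∀ i, rkHom α (m i) (d i)) :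
    ∃ ψ : C(ℝ, A → A), (∀ t, RkUCP α (ψ t)) ∧
      ∀ i, Tendsto (fun t => ‖ψ t (d i) - d i * rkW (m i) (v t)‖) atTop (𝓝 0) := by
  have ex : ∀ k : ℕ, ∃ N : ℕ, 0 < N ∧ ∃ T : ℝ, (k : ℝ) ≤ T ∧ ∀ t ≥ T, ∀ i ∈ Finset.range (k + 1),
      ‖rkPsi α N (v t) (d i) - d i * rkW (m i) (v t)‖ ≤ 1 / ((k : ℝ) + 1) := by
    intro k
    have hk : (0 : ℝ) < 1 / ((k : ℝ) + 1) := by positivity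
    have h3 : ∀ᶠ N : ℕ in atTop, ∀ i ∈ Finset.range (k + 1), ∀ᶠ t in atTop,
        ‖rkPsi α N (v t) (d i) - d i * rkW (m i) (v t)‖ ≤ 1 / ((k : ℝ) + 1) :=
      (Filter.eventually_all_finset _).2 fun i _ => rkPsi_eventually hα (hd i) h1 h2 hk
    obtain ⟨N, hN, hN0⟩ := (h3.and (eventually_gt_atTop 0)).exists
    have h4 := (Filter.eventually_all_finset _).2 hN
    obtain ⟨T, hT⟩ := eventually_atTop.1 h4
    exact ⟨N, hN0, max k T, le_max_left _ _, fun t ht => hT t ((le_max_right _ _).trans ht)⟩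
  choose N hN T hT hNT using ex
  let S : ℝ → Set (A → A) := fun t => {φ | RkUCP α φ} ∩
    {φ | ∀ k : ℕ, T k + 1 ≤ t → ∀ i ≤ k, ‖φ (d i) - d i * rkW (m i) (v t)‖ ≤ 1 / ((k : ℝ) + 1)}
  have hS : ∀ t, Convex ℝ (S t) := by
    intro t
    refine (rkUCP_convex α).inter ?_
    intro φ hφ ψ hψ r s hr hs hrs k hk i hi
    have q1 := hφ k hk i hi
    have q2 := hψ k hk i hi
    have e : (r • φ + s • ψ) (d i) - d i * rkW (m i) (v t) =
        r • (φ (d i) - d i * rkW (m i) (v t)) + s • (ψ (d i) - d i * rkW (m i) (v t)) := by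
      have : d i * rkW (m i) (v t) = (r + s) • (d i * rkW (m i) (v t)) := by rw [hrs, one_smul]
      conv_lhs => rw [this]
      simp only [Pi.add_apply, Pi.smul_apply, add_smul, smul_sub]
      abel
    rw [e]
    refine (norm_add_le _ _).trans ?_
    rw [norm_smul, norm_smul, Real.norm_of_nonneg hr, Real.norm_of_nonneg hs]
    calc _ ≤ r * (1 / ((k : ℝ) + 1)) + s * (1 / ((k : ℝ) + 1)) := by gcongr
      _ = _ := by rw [← add_mul, hrs, one_mul]
  obtain ⟨ψ, hψ⟩ := exists_continuous_forall_mem_convex_of_local hS (by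
    intro x
    refine ⟨Set.Ioo (x - 1 / 2) (x + 1 / 2), Ioo_mem_nhds (by linarith) (by linarith), ?_⟩
    by_cases h : ∃ k, T k ≤ x - 1 / 2
    · obtain ⟨k0, hk0⟩ := h
      classical
      let K := Nat.findGreatest (fun k => T k ≤ x - 1 / 2) ⌈x⌉₊
      have hb : ∀ k, T k ≤ x - 1 / 2 → k ≤ ⌈x⌉₊ := by
        intro k hk
        have h3 : (k : ℝ) ≤ (⌈x⌉₊ : ℝ) := by linarith [hT k, Nat.le_ceil x]
        exact_mod_cast h3
      have hK : T K ≤ x - 1 / 2 :=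
        Nat.findGreatest_spec (P := fun k => T k ≤ x - 1 / 2) (hb k0 hk0) hk0
      refine ⟨fun t => rkPsi α (N K) (v t), ?_, ?_⟩
      · exact (continuous_pi fun a => rkPsi_cont hα _ a hv).continuousOn
      · intro y hy
        refine ⟨rkPsi_ucp hα (hN K) _, fun k hk i hi => ?_⟩
        have hk' : T k ≤ x - 1 / 2 := by linarith [hy.2]
        have hkK : k ≤ K := Nat.le_findGreatest (hb k hk') hk'
        refine (hNT K y (by linarith [hy.1]) i (Finset.mem_range.2 (by lia))).trans ?_
        have : (k : ℝ) ≤ K := by exact_mod_cast hkK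
        exact one_div_le_one_div_of_le (by positivity) (by linarith)
    · push Not at h
      refine ⟨fun t => rkPsi α 1 (v t), ?_, ?_⟩
      · exact (continuous_pi fun a => rkPsi_cont hα _ a hv).continuousOn
      · intro y hy
        refine ⟨rkPsi_ucp hα one_pos _, fun k hk i hi => ?_⟩
        linarith [h k, hy.2])
  refine ⟨ψ, fun t => (hψ t).1, fun i => ?_⟩
  rw [Metric.tendsto_atTop]
  intro ε hε
  obtain ⟨k0, hk0⟩ := exists_nat_one_div_lt hε
  refine ⟨T (max i k0) + 1, fun t ht => ?_⟩
  have := (hψ t).2 (max i k0) ht i (le_max_left _ _)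
  rw [Real.dist_eq, sub_zero, abs_norm]
  refine this.trans_lt (lt_of_le_of_lt ?_ hk0)
  have : (k0 : ℝ) ≤ (max i k0 : ℕ) := by exact_mod_cast le_max_right _ _
  exact one_div_le_one_div_of_le (by positivity) (by linarith)

lemma rk_null_mem (L : ℝ → A →ₗ[ℂ] A) (C : ℝ) (hC : ∀ᶠ t in atTop, ∀ a, ‖L t a‖ ≤ C * ‖a‖)
    (s : Set A) (hs : ∀ a ∈ s, Tendsto (fun t => L t a) atTop (𝓝 0)) (a : A) (ha : a ∈ closure s) :
    Tendsto (fun t => L t a) atTop (𝓝 0) := by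
  have hC0 : 0 < |C| + 1 := by positivity
  rw [Metric.tendsto_nhds]
  intro ε hε
  obtain ⟨b, hb, hab⟩ := Metric.mem_closure_iff.1 ha (ε / 2 / (|C| + 1)) (by positivity)
  have := Metric.tendsto_nhds.1 (hs b hb) (ε / 2) (by positivity)
  filter_upwards [this, hC] with t ht hCt
  rw [dist_zero_right] at ht ⊢
  have e : L t a = L t (a - b) + L t b := by rw [← map_add, sub_add_cancel]
  rw [e]
  refine (norm_add_le _ _).trans_lt ?_
  rw [dist_eq_norm, lt_div_iff₀ hC0] at hab
  have h1 := hCt (a - b)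
  have h2 : C * ‖a - b‖ ≤ (|C| + 1) * ‖a - b‖ := by
    gcongr
    linarith [le_abs_self C]
  linarith

lemma rk_null_all {α : Circle → A ≃⋆ₐ[ℂ] A} (hα : IsCircleAction α)
    (L : ℝ → A →ₗ[ℂ] A) (C : ℝ) (hC : ∀ᶠ t in atTop, ∀ a, ‖L t a‖ ≤ C * ‖a‖)
    (hs : ∀ m a, rkHom α m a → Tendsto (fun t => L t a) atTop (𝓝 0)) (a : A) :
    Tendsto (fun t => L t a) atTop (𝓝 0) := by
  let M : Submodule ℂ A :=
    { carrier := {a | Tendsto (fun t => L t a) atTop (𝓝 0)}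
      add_mem' := fun {a b} ha hb => by
        have := Filter.Tendsto.add ha hb
        simpa using this
      zero_mem' := by simp
      smul_mem' := fun c a ha => by
        have := Filter.Tendsto.const_smul ha c
        simpa using this }
  have hM : IsClosed (M : Set A) :=
    isClosed_of_closure_subset fun a ha => rk_null_mem L C hC _ (fun a ha => ha) a ha
  exact rk_dense hα M hM (fun m a => hs m _ (rkAct_rkP hα m a)) a

lemma rk_final [PartialOrder A] [StarOrderedRing A] [Nontrivial A]
    [TopologicalSpace.SeparableSpace A] {α : Circle → A ≃⋆ₐ[ℂ] A}
    (hα : IsCircleAction α) {v : ℝ → unitary A} (hv : Continuous v)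
    (h1 : ∀ ε > (0 : ℝ), ∀ᶠ t in atTop, ∀ x : UnitAddCircle,
      ‖rkAct α x (v t : A) - fourier 1 x • (v t : A)‖ ≤ ε)
    (h2 : ∀ a : A, Tendsto (fun t : ℝ => ‖(v t : A) * a - a * v t‖) atTop (𝓝 0)) :
    ∃ ψ : C(ℝ, A → A), (∀ t, RkUCP α (ψ t)) ∧
      (∀ a b, Tendsto (fun t => ‖ψ t (a * b) - ψ t a * ψ t b‖) atTop (𝓝 0)) ∧
      ∀ a, rkHom α 0 a → Tendsto (fun t => ‖ψ t a - a‖) atTop (𝓝 0) := by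
  let e := TopologicalSpace.denseSeq A
  let q : ℕ → ℕ × ℤ := Denumerable.ofNat (ℕ × ℤ)
  obtain ⟨ψ, hψ, hlim⟩ := rk_select hα hv h1 h2 (fun n => rkP α (q n).2 (e (q n).1))
    (fun n => (q n).2) (fun n => rkAct_rkP hα _ _)
  have hlim1 : ∀ m a, rkHom α m a →
      Tendsto (fun t => ψ t a - a * rkW m (v t)) atTop (𝓝 0) := by
    intro m a ha
    let L : ℝ → A →ₗ[ℂ] A := fun t =>
      ((hψ t).lin.mk' - LinearMap.mulRight ℂ (rkW m (v t))) ∘ₗ (rkPL hα m : A →ₗ[ℂ] A)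
    have hL : ∀ t b, L t b = ψ t (rkP α m b) - rkP α m b * rkW m (v t) := fun t b => rfl
    have := rk_null_mem L 7 (.of_forall fun t b => by
      rw [hL]
      refine (norm_sub_le _ _).trans ?_
      rw [rk_norm_mul_W]
      linarith [(hψ t).norm_le (rkP α m b), rkP_norm_le α m b]) (Set.range e) (by
      rintro _ ⟨i, rfl⟩
      have h3 := hlim (Encodable.encode (i, m))
      simp only [q, Denumerable.ofNat_encode] at h3
      exact tendsto_zero_iff_norm_tendsto_zero.2 h3) a (TopologicalSpace.denseRange_denseSeq A a)
    simpa only [hL, rkP_of_hom ha, if_true] using this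
  have hmul : ∀ m k a b, rkHom α m a → rkHom α k b →
      Tendsto (fun t => ψ t (a * b) - ψ t a * ψ t b) atTop (𝓝 0) := by
    intro m k a b ha hb
    have l1 := (hlim1 _ _ (rkHom_mul ha hb)).norm
    have l2 := ((hlim1 _ _ ha).norm).mul_const (6 * ‖b‖)
    have l3 := ((hlim1 _ _ hb).norm).const_mul ‖a‖
    have l4 := (h2 b).const_mul (‖a‖ * |(m : ℝ)|)
    have l := ((l1.add l2).add l3).add l4
    simp only [norm_zero, zero_mul, mul_zero, add_zero] at l
    refine squeeze_zero_norm (fun t => ?_) l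
    have e : ψ t (a * b) - ψ t a * ψ t b = (ψ t (a * b) - a * b * rkW (m + k) (v t))
        - (ψ t a - a * rkW m (v t)) * ψ t b
        - a * rkW m (v t) * (ψ t b - b * rkW k (v t))
        - a * (rkW m (v t) * b - b * rkW m (v t)) * rkW k (v t) := by
      rw [rkW_add]
      noncomm_ring
    rw [e]
    refine (norm_sub_le _ _).trans (add_le_add ((norm_sub_le _ _).trans (add_le_add
      ((norm_sub_le _ _).trans (add_le_add le_rfl ?_)) ?_)) ?_)
    · refine (norm_mul_le _ _).trans ?_
      gcongr
      exact (hψ t).norm_le b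
    · refine (norm_mul_le _ _).trans ?_
      rw [rk_norm_mul_W]
    · rw [rk_norm_mul_W]
      refine (norm_mul_le _ _).trans ?_
      rw [mul_assoc]
      gcongr
      exact rk_comm_W _ _ _
  have hbd : ∀ t a b, ‖ψ t (a * b) - ψ t a * ψ t b‖ ≤ 42 * ‖a‖ * ‖b‖ := by
    intro t a b
    have q1 := (hψ t).norm_le (a * b)
    have q2 := norm_mul_le a b
    have q3 := norm_mul_le (ψ t a) (ψ t b)
    have q4 := mul_le_mul ((hψ t).norm_le a) ((hψ t).norm_le b) (norm_nonneg _) (by positivity)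
    have q5 := norm_sub_le (ψ t (a * b)) (ψ t a * ψ t b)
    nlinarith
  have hmul2 : ∀ k a b, rkHom α k b →
      Tendsto (fun t => ψ t (a * b) - ψ t a * ψ t b) atTop (𝓝 0) := by
    intro k a b hb
    let L : ℝ → A →ₗ[ℂ] A := fun t =>
      (hψ t).lin.mk' ∘ₗ LinearMap.mulRight ℂ b - LinearMap.mulRight ℂ (ψ t b) ∘ₗ (hψ t).lin.mk'
    refine rk_null_all hα L (42 * ‖b‖) (.of_forall fun t a => ?_) (fun m a ha => ?_) a
    · exact (hbd t a b).trans_eq (by ring)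
    · exact hmul m k a b ha hb
  refine ⟨ψ, hψ, fun a b => ?_, fun a ha => ?_⟩
  · let L : ℝ → A →ₗ[ℂ] A := fun t =>
      (hψ t).lin.mk' ∘ₗ LinearMap.mulLeft ℂ a - LinearMap.mulLeft ℂ (ψ t a) ∘ₗ (hψ t).lin.mk'
    refine tendsto_zero_iff_norm_tendsto_zero.1
      (rk_null_all hα L (42 * ‖a‖) (.of_forall fun t b => ?_) (fun m b hb => ?_) b)
    · exact hbd t a b
    · exact hmul2 m a b hb
  · have := hlim1 0 a ha
    simp only [rkW_zero, mul_one] at this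
    exact tendsto_zero_iff_norm_tendsto_zero.1 this

end Helpers


/-- Theorem (existence of an asymptotic left inverse for the inclusion of the fixed point
algebra): if a circle action on a separable unital C*-algebra has the continuous Rokhlin
property, there is a unital completely positive asymptotic morphism `ψ : A → A^α` which is
asymptotically a left inverse for the inclusion `A^α → A`. -/
theorem exists_asymptotic_morphism_of_continuousRokhlin {A : Type*} [CStarAlgebra A]
    [Nontrivial A] [PartialOrder A] [StarOrderedRing A] [TopologicalSpace.SeparableSpace A]
    (α : Circle → A ≃⋆ₐ[ℂ] A) (hα : IsCircleAction α) (hcR : ContinuousRokhlin α) :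
    ∃ ψ : ℝ → A → A,
      (∀ t ∈ Set.Ici (1 : ℝ),
        IsLinearMap ℂ (ψ t) ∧
        ψ t 1 = 1 ∧
        (∀ a : A, ψ t (star a) = star (ψ t a)) ∧
        (∀ a : A, ∀ ζ : Circle, α ζ (ψ t a) = ψ t a) ∧
        (∀ n : ℕ, ∀ a b : Fin n → A,
          0 ≤ ∑ i : Fin n, ∑ j : Fin n, star (b i) * ψ t (star (a i) * a j) * b j)) ∧
      (∀ a : A, ContinuousOn (fun t : ℝ => ψ t a) (Set.Ici (1 : ℝ))) ∧
      (∀ a b : A,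
        Tendsto (fun t : ℝ => ‖ψ t (a * b) - ψ t a * ψ t b‖) atTop (𝓝 0)) ∧
      (∀ a : A, (∀ ζ : Circle, α ζ a = a) →
        Tendsto (fun t : ℝ => ‖ψ t a - a‖) atTop (𝓝 0)) := by
  obtain ⟨u, hu, huu, hu1, hu2⟩ := hcR
  let v : ℝ → unitary A := fun t => ⟨u (max t 1), huu _ (le_max_right t 1)⟩
  have hv : Continuous v := Continuous.subtype_mk
    (hu.comp_continuous (continuous_id.max continuous_const) fun t => le_max_right t 1) _
  have hev : ∀ᶠ t : ℝ in atTop, (v t : A) = u t := by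
    filter_upwards [eventually_ge_atTop 1] with t ht
    simp [v, max_eq_left ht]
  obtain ⟨ψ, hψ, hm, hf⟩ := rk_final hα hv (fun ε hε => by
    obtain ⟨T, hT⟩ := hu1 ε hε
    filter_upwards [hev, eventually_ge_atTop T] with t ht htT x
    rw [ht, fourier_one]
    exact (hT t htT _).le) (fun a => by
    refine (hu2 a).congr' ?_
    filter_upwards [hev] with t ht
    rw [ht])
  refine ⟨fun t => ψ t, fun t _ => ⟨(hψ t).lin, (hψ t).one, (hψ t).star, (hψ t).fix, (hψ t).cp⟩,
    fun a => ((continuous_apply a).comp ψ.continuous).continuousOn, hm, fun a ha => hf a ?_⟩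
  intro x
  simp [rkAct, ha]
end

section
/- Let A be a commutative unital C*-algebra and let α be a continuous action of the circle group 𝕋 on A with the Rokhlin property. Then α has the continuous Rokhlin property. -/
open Filter Topology

/-- The Rokhlin property for a circle action on a unital C*-algebra. -/
def Rokhlin {A : Type*} [CStarAlgebra A] (α : Circle → A ≃⋆ₐ[ℂ] A) : Prop :=
  ∀ ε > (0 : ℝ), ∀ F : Finset A, ∃ u ∈ unitary A,
    (∀ ζ : Circle, ‖α ζ u - (ζ : ℂ) • u‖ < ε) ∧ ∀ a ∈ F, ‖u * a - a * u‖ < ε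

lemma aux_unitary {A : Type*} [CommCStarAlgebra A] (α : Circle → A ≃⋆ₐ[ℂ] A) (b : A)
    (hb : IsUnit b) (h : ∀ η : Circle, α η b = (η : ℂ) • b) :
    ∃ w ∈ unitary A, ∀ η : Circle, α η w = (η : ℂ) • w := by
  set p : A := star b * b with hp
  have hpsa : IsSelfAdjoint p := IsSelfAdjoint.star_mul_self b
  have hpu : IsUnit p := hb.star.mul hb
  have hpos : ∀ x ∈ spectrum ℝ p, 0 < x := by
    intro x hx
    have h1 : 0 ≤ x := spectrum_star_mul_self_nonneg x hx
    have h2 : x ≠ 0 := by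
      rintro rfl
      exact spectrum.zero_notMem ℝ hpu hx
    exact lt_of_le_of_ne h1 h2.symm
  have hcont : ContinuousOn (fun x : ℝ => (√x)⁻¹) (spectrum ℝ p) :=
    Real.continuous_sqrt.continuousOn.inv₀ fun x hx => (Real.sqrt_pos.2 (hpos x hx)).ne'
  set c : A := cfc (fun x : ℝ => (√x)⁻¹) p with hc
  have hcsa : star c = c := (cfc_predicate (fun x : ℝ => (√x)⁻¹) p : IsSelfAdjoint c)
  have hccp : c * c * p = 1 := by
    have e : p = cfc (fun x : ℝ => x) p := (cfc_id' ℝ p).symm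
    calc c * c * p = c * c * cfc (fun x : ℝ => x) p := by rw [← e]
      _ = cfc (fun x : ℝ => (√x)⁻¹ * (√x)⁻¹ * x) p := by
        rw [cfc_mul (fun x : ℝ => (√x)⁻¹ * (√x)⁻¹) (fun x => x) p (hcont.mul hcont)
          continuousOn_id, cfc_mul _ _ p hcont hcont]
      _ = cfc (fun _ : ℝ => (1:ℝ)) p := by
        refine cfc_congr fun x hx => ?_
        have := hpos x hx
        have h3 := Real.sqrt_pos.2 this
        have h4 := Real.mul_self_sqrt this.le
        field_simp
        nlinarith
      _ = 1 := cfc_const_one ℝ p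
  have hαp : ∀ η : Circle, α η p = p := by
    intro η
    rw [hp, map_mul, map_star, h, star_smul, smul_mul_smul_comm]
    simp [← Complex.normSq_eq_conj_mul_self]
  have hαc : ∀ η : Circle, α η c = c := by
    intro η
    have hct : Continuous (α η) := (StarAlgEquiv.isometry (α η)).continuous
    rw [hc, StarAlgHomClass.map_cfc (R := ℝ) (S := ℂ) (α η) _ p hcont hct hpsa
      (by rw [hαp]; exact hpsa), hαp]
  have key : star (b * c) * (b * c) = 1 := by
    rw [star_mul, hcsa, ← hccp, hp]; ring
  refine ⟨b * c, ?_, fun η => ?_⟩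
  · rw [Unitary.mem_iff]
    exact ⟨key, by rw [mul_comm]; exact key⟩
  · rw [map_mul, h, hαc, smul_mul_assoc]

lemma aux_average {A : Type*} [CommCStarAlgebra A] [Nontrivial A]
    (α : Circle → A ≃⋆ₐ[ℂ] A) (hα : IsCircleAction α) (u : A) (hu : u ∈ unitary A)
    (h : ∀ ζ : Circle, ‖α ζ u - (ζ : ℂ) • u‖ < 1 / 2) :
    ∃ b : A, IsUnit b ∧ ∀ η : Circle, α η b = (η : ℂ) • b := by
  let : MeasurableSpace Circle := borel Circle
  have : BorelSpace Circle := ⟨rfl⟩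
  let μ : MeasureTheory.Measure Circle := MeasureTheory.Measure.haarMeasure ⊤
  have : MeasureTheory.IsProbabilityMeasure μ :=
    ⟨by simpa using MeasureTheory.Measure.haarMeasure_self (K₀ := (⊤ : TopologicalSpace.PositiveCompacts Circle))⟩
  let f : Circle → A := fun ζ => ((ζ⁻¹ : Circle) : ℂ) • α ζ u
  have hf : Continuous f :=
    (continuous_subtype_val.comp (continuous_inv (G := Circle))).smul (hα.2 u)
  have hint : MeasureTheory.Integrable f μ :=
    hf.integrable_of_hasCompactSupport (HasCompactSupport.of_compactSpace f)
  have hαf : ∀ η ζ : Circle, α η (f ζ) = (η : ℂ) • f (η * ζ) := by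
    intro η ζ
    simp only [f]
    rw [map_smul, ← hα.1, smul_smul, ← Circle.coe_mul]
    have e : η * (η * ζ)⁻¹ = ζ⁻¹ := by rw [mul_inv_rev, mul_comm ζ⁻¹, mul_inv_cancel_left]
    rw [e]
  refine ⟨∫ ζ, f ζ ∂μ, ?_, fun η => ?_⟩
  · have hn : ‖(∫ ζ, f ζ ∂μ) - u‖ ≤ 1 / 2 := by
      have e : (∫ ζ, f ζ ∂μ) - u = ∫ ζ, (f ζ - u) ∂μ := by
        rw [MeasureTheory.integral_sub hint (MeasureTheory.integrable_const u)]
        simp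
      rw [e]
      have := MeasureTheory.norm_integral_le_of_norm_le_const (μ := μ) (f := fun ζ => f ζ - u)
        (C := 1 / 2) (Eventually.of_forall fun ζ => ?_)
      · simpa using this
      · have e2 : f ζ - u = ((ζ⁻¹ : Circle) : ℂ) • (α ζ u - (ζ : ℂ) • u) := by
          simp only [f]
          rw [smul_sub, smul_smul, ← Circle.coe_mul]
          simp
        simp only [e2]
        rw [norm_smul, Circle.norm_coe, one_mul]
        exact (h ζ).le
    have hu1 : star u * u = 1 := (Unitary.mem_iff.1 hu).1
    set b := ∫ ζ, f ζ ∂μ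
    have h1 : ‖star u * (u - b)‖ < 1 := by
      have h2 : ‖star u‖ = 1 := CStarRing.norm_of_mem_unitary (Unitary.star_mem hu)
      calc ‖star u * (u - b)‖ ≤ ‖star u‖ * ‖u - b‖ := norm_mul_le _ _
        _ ≤ 1 / 2 := by rw [h2, one_mul, norm_sub_rev]; exact hn
        _ < 1 := by norm_num
    have h3 := isUnit_one_sub_of_norm_lt_one h1
    rw [mul_sub, hu1, sub_sub_cancel] at h3
    exact isUnit_of_mul_isUnit_right h3
  · have hct : Continuous (α η) := (StarAlgEquiv.isometry (α η)).continuous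
    let L : A →L[ℂ] A := ⟨((α η : A ≃⋆ₐ[ℂ] A).toAlgEquiv.toLinearMap), hct⟩
    have e := L.integral_comp_comm hint
    have e' : α η (∫ ζ, f ζ ∂μ) = ∫ ζ, α η (f ζ) ∂μ := e.symm
    rw [e']
    simp_rw [hαf]
    rw [MeasureTheory.integral_smul, MeasureTheory.integral_mul_left_eq_self f η]

/-- For circle actions on commutative unital C*-algebras, the Rokhlin property implies the
continuous Rokhlin property. -/
theorem continuousRokhlin_of_rokhlin_comm {A : Type*} [CommCStarAlgebra A] [Nontrivial A]
    (α : Circle → A ≃⋆ₐ[ℂ] A) (hα : IsCircleAction α) (hR : Rokhlin α) :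
    ContinuousRokhlin α := by
  obtain ⟨u, hu, h, -⟩ := hR (1 / 2) (by norm_num) ∅
  obtain ⟨b, hb, hb'⟩ := aux_average α hα u hu h
  obtain ⟨w, hw, hw'⟩ := aux_unitary α b hb hb'
  refine ⟨fun _ => w, continuousOn_const, fun _ _ => hw, fun ε hε => ⟨0, fun t _ ζ => ?_⟩,
    fun a => ?_⟩
  · rw [hw']; simpa using hε
  · simp [mul_comm]
end
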